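/- arXiv:math/0703516 — 2 statements merged into one kernel-verified Lean document; each statement's English description precedes it below -/
import Mathlib

section
/- Let f ∈ 𝓕 have at least one node, let n be a positive integer, let b = f⁻ⁿ(x_f), and let a ∈ (b, f(b)). Then with m = α_f and t = log_m(a/b), one has ψ_f^a(s) = ψ_f(s + t mod 1) for all s ∈ 𝕊. In particular, for every a ∈ (0, x_f), ψ_f^a agrees with ψ_f up to a translation of the circle 𝕊. -/
open Set Function

/-- `f` is locally affine at `x`: it agrees with an affine map on a neighbourhood of `x`. -/
def LocallyAffineAt (f : ℝ → ℝ) (x : ℝ) : Prop :=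
  ∃ a b : ℝ, ∀ᶠ y in nhds x, f y = a * y + b

/-- `x` is a node of `f`: a point of `(0,1)` at which `f` is not locally affine. -/
def IsNode (f : ℝ → ℝ) (x : ℝ) : Prop :=
  x ∈ Set.Ioo (0 : ℝ) 1 ∧ ¬ LocallyAffineAt f x

/-- Membership of the group `PLF⁺([0,1])` of orientation-preserving piecewise linear
homeomorphisms of `[0,1]` that are locally affine at all but finitely many points of `(0,1)`.
Such a homeomorphism is modelled as a map `ℝ → ℝ` that equals the identity outside `[0,1]`,
so that composition and (function) inverse model the group structure. -/
structure IsPLF (f : ℝ → ℝ) : Prop where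
  map_zero : f 0 = 0
  map_one : f 1 = 1
  strictMonoOn : StrictMonoOn f (Set.Icc 0 1)
  continuousOn : ContinuousOn f (Set.Icc 0 1)
  surjOn : Set.SurjOn f (Set.Icc 0 1) (Set.Icc 0 1)
  eq_id : ∀ x : ℝ, x ∉ Set.Icc (0 : ℝ) 1 → f x = x
  finite_nodes : {x : ℝ | IsNode f x}.Finite

/-- Membership of `𝓕`: elements of `PLF⁺([0,1])` with `f x > x` on `(0,1)`. -/
def MemF (f : ℝ → ℝ) : Prop :=
  IsPLF f ∧ ∀ x ∈ Set.Ioo (0 : ℝ) 1, x < f x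

/-- `f` has at least one node. -/
def HasNode (f : ℝ → ℝ) : Prop := ∃ x, IsNode f x

/-- The left derivative `f'₋(x)`. -/
noncomputable def leftDeriv (f : ℝ → ℝ) (x : ℝ) : ℝ := derivWithin f (Set.Iic x) x

/-- The right derivative `f'₊(x)`. -/
noncomputable def rightDeriv (f : ℝ → ℝ) (x : ℝ) : ℝ := derivWithin f (Set.Ici x) x

/-- `f*(x) = f'₊(x) / f'₋(x)`. -/
noncomputable def fstar (f : ℝ → ℝ) (x : ℝ) : ℝ := rightDeriv f x / leftDeriv f x

/-- `x_f`, the smallest node of `f` (for `f ∈ 𝓕` with at least one node). -/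
noncomputable def firstNode (f : ℝ → ℝ) : ℝ := sInf {x | IsNode f x}

/-- `y_f`, the largest node of `f`. -/
noncomputable def lastNode (f : ℝ → ℝ) : ℝ := sSup {x | IsNode f x}

/-- `α_f = f'₋(x_f)`. -/
noncomputable def alphaF (f : ℝ → ℝ) : ℝ := leftDeriv f (firstNode f)

/-- `φ_f^a(x) = ∏_{n=0}^∞ f*(fⁿ(x))` (independent of `a` as a formula; `a` only
fixes the domain `[a, f a)`). -/
noncomputable def phi (f : ℝ → ℝ) (x : ℝ) : ℝ := ∏' n : ℕ, fstar f (f^[n] x)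

/-- `ψ_f^a(s) = φ_f^a(α_f ^ s * a)`, a function on the circle `𝕊 = [0,1]/(0∼1)`,
represented by its values for `s ∈ [0,1)`. -/
noncomputable def psiA (f : ℝ → ℝ) (a s : ℝ) : ℝ := phi f (alphaF f ^ s * a)

/-- `ψ_f = ψ_f^{x_f}`. -/
noncomputable def psi (f : ℝ → ℝ) (s : ℝ) : ℝ := psiA f (firstNode f) s

/-- `f` and `g` are conjugate in `PLF⁺([0,1])`: `h f h⁻¹ = g` for some `h` in the group. -/
def IsConjPLF (f g : ℝ → ℝ) : Prop :=
  ∃ h : ℝ → ℝ, IsPLF h ∧ h ∘ f ∘ Function.invFun h = g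

/-- A corner function: a member of `𝓕` (with at least one node) all of whose nodes
lie in `[x_f, f x_f)`. -/
def CornerFun (f : ℝ → ℝ) : Prop :=
  MemF f ∧ HasNode f ∧ ∀ x, IsNode f x → x ∈ Set.Ico (firstNode f) (f (firstNode f))

theorem IsPLF.injective {f : ℝ → ℝ} (hf : IsPLF f) : Injective f := by
  have hmaps : ∀ x ∈ Icc (0 : ℝ) 1, f x ∈ Icc (0 : ℝ) 1 := fun x hx =>
    ⟨hf.map_zero ▸ hf.strictMonoOn.monotoneOn (left_mem_Icc.2 zero_le_one) hx hx.1,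
      hf.map_one ▸ hf.strictMonoOn.monotoneOn hx (right_mem_Icc.2 zero_le_one) hx.2⟩
  intro x y hxy
  by_cases hx : x ∈ Icc (0 : ℝ) 1 <;> by_cases hy : y ∈ Icc (0 : ℝ) 1
  · exact hf.strictMonoOn.injOn hx hy hxy
  · exact absurd (hf.eq_id y hy ▸ hxy ▸ hmaps x hx) hy
  · exact absurd (hf.eq_id x hx ▸ hxy.symm ▸ hmaps y hy) hx
  · rw [← hf.eq_id x hx, ← hf.eq_id y hy, hxy]

theorem IsPLF.isNode_firstNode {f : ℝ → ℝ} (hf : IsPLF f) (hfn : HasNode f) :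
    IsNode f (firstNode f) :=
  Set.Nonempty.csInf_mem hfn hf.finite_nodes

theorem IsPLF.locallyAffineAt_of_lt_firstNode {f : ℝ → ℝ} (hf : IsPLF f) (hfn : HasNode f)
    {x : ℝ} (hx : x ∈ Ioo 0 (firstNode f)) : LocallyAffineAt f x := by
  by_contra h
  have h1 := (hf.isNode_firstNode hfn).1.2
  have hle : firstNode f ≤ x :=
    csInf_le hf.finite_nodes.bddBelow ⟨⟨hx.1, hx.2.trans h1⟩, h⟩
  exact absurd hx.2 hle.not_gt

/-- A function that is locally affine on an open interval is affine there. -/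
theorem exists_eqOn_affine_of_locallyAffineAt {f : ℝ → ℝ} {u v : ℝ}
    (h : ∀ x ∈ Ioo u v, LocallyAffineAt f x) :
    ∃ m c : ℝ, ∀ x ∈ Ioo u v, f x = m * x + c := by
  have hd : ∀ x ∈ Ioo u v, DifferentiableAt ℝ f x ∧ HasDerivAt (deriv f) 0 x := by
    intro x hx
    obtain ⟨p, q, hpq⟩ := h x hx
    have haff : ∀ z, HasDerivAt (fun y => p * y + q) p z := fun z => by
      simpa using ((hasDerivAt_id z).const_mul p).add_const q
    refine ⟨((haff x).congr_of_eventuallyEq hpq).differentiableAt, ?_⟩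
    refine (hasDerivAt_const x p).congr_of_eventuallyEq ?_
    filter_upwards [hpq.eventually_nhds] with y hy
    exact ((haff y).congr_of_eventuallyEq hy).deriv
  rcases (Ioo u v).eq_empty_or_nonempty with he | ⟨w, hw⟩
  · exact ⟨0, 0, by simp [he]⟩
  have hm : ∀ x ∈ Ioo u v, deriv f x = deriv f w := fun x hx =>
    isOpen_Ioo.is_const_of_deriv_eq_zero isPreconnected_Ioo
      (fun z hz => (hd z hz).2.differentiableAt.differentiableWithinAt)
      (fun z hz => (hd z hz).2.deriv) hx hw
  have hsub : ∀ x ∈ Ioo u v, HasDerivAt (fun y => f y - deriv f w * y) 0 x := by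
    intro x hx
    have := (hd x hx).1.hasDerivAt.fun_sub ((hasDerivAt_id x).const_mul (deriv f w))
    simpa [hm x hx] using this
  refine ⟨deriv f w, f w - deriv f w * w, fun x hx => ?_⟩
  have := isOpen_Ioo.is_const_of_deriv_eq_zero isPreconnected_Ioo
      (fun z hz => (hsub z hz).differentiableAt.differentiableWithinAt)
      (fun z hz => (hsub z hz).deriv) hx hw
  linarith

theorem IsPLF.eq_alphaF_mul {f : ℝ → ℝ} (hf : IsPLF f) (hfn : HasNode f) {x : ℝ}
    (hx : x ∈ Icc 0 (firstNode f)) : f x = alphaF f * x := by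
  obtain ⟨⟨h0, h1⟩, -⟩ := hf.isNode_firstNode hfn
  obtain ⟨m, c, hmc⟩ := exists_eqOn_affine_of_locallyAffineAt
    fun x hx => hf.locallyAffineAt_of_lt_firstNode hfn hx
  have hIcc : EqOn f (fun y => m * y + c) (Icc 0 (firstNode f)) :=
    Set.EqOn.of_subset_closure hmc (hf.continuousOn.mono (Icc_subset_Icc_right h1.le))
      (by fun_prop) Ioo_subset_Icc_self (closure_Ioo h0.ne).ge
  have hc : c = 0 := by
    simpa [hf.map_zero] using (hIcc (left_mem_Icc.2 h0.le)).symm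
  have hm : alphaF f = m := by
    refine HasDerivWithinAt.derivWithin ?_ (uniqueDiffWithinAt_Iic _)
    have haff : HasDerivWithinAt (fun y => m * y + c) m (Iic (firstNode f)) (firstNode f) := by
      simpa using (((hasDerivAt_id (firstNode f)).const_mul m).add_const c).hasDerivWithinAt
    refine haff.congr_of_eventuallyEq ?_ (hIcc (right_mem_Icc.2 h0.le))
    filter_upwards [self_mem_nhdsWithin, mem_nhdsWithin_of_mem_nhds (Ioi_mem_nhds h0)]
      with y hy hy0
    exact hIcc ⟨le_of_lt hy0, hy⟩
  simpa [hm, hc] using hIcc hx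

theorem MemF.one_lt_alphaF {f : ℝ → ℝ} (hf : MemF f) (hfn : HasNode f) : 1 < alphaF f := by
  have hx := (hf.1.isNode_firstNode hfn).1
  have h := hf.2 _ hx
  rw [hf.1.eq_alphaF_mul hfn (right_mem_Icc.2 hx.1.le)] at h
  exact (lt_mul_iff_one_lt_left hx.1).1 h

theorem MemF.fstar_eq_one {f : ℝ → ℝ} (hf : MemF f) (hfn : HasNode f) {x : ℝ}
    (hx : x ∈ Ioo 0 (firstNode f)) : fstar f x = 1 := by
  have hd : HasDerivAt f (alphaF f) x := by
    have haff : HasDerivAt (fun y => alphaF f * y) (alphaF f) x := by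
      simpa using (hasDerivAt_id x).const_mul (alphaF f)
    refine haff.congr_of_eventuallyEq ?_
    filter_upwards [Ioo_mem_nhds hx.1 hx.2] with y hy
    exact hf.1.eq_alphaF_mul hfn (Ioo_subset_Icc_self hy)
  rw [fstar, rightDeriv, leftDeriv, hd.hasDerivWithinAt.derivWithin (uniqueDiffWithinAt_Ici x),
    hd.hasDerivWithinAt.derivWithin (uniqueDiffWithinAt_Iic x)]
  exact div_self (zero_lt_one.trans (hf.one_lt_alphaF hfn)).ne'

theorem phi_map_of_fstar_eq_one {f : ℝ → ℝ} {x : ℝ} (hx : fstar f x = 1) :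
    phi f (f x) = phi f x := by
  refine Nat.succ_injective.tprod_eq (f := fun n => fstar f (f^[n] x)) fun k hk => ?_
  cases k with
  | zero => exact absurd hx hk
  | succ k => exact ⟨k, rfl⟩

theorem MemF.phi_div_alphaF_pow {f : ℝ → ℝ} (hf : MemF f) (hfn : HasNode f) {y : ℝ}
    (hy : y ∈ Ioo 0 (alphaF f * firstNode f)) (k : ℕ) :
    phi f (y / alphaF f ^ k) = phi f y := by
  have hm := hf.one_lt_alphaF hfn
  have hm0 : 0 < alphaF f := zero_lt_one.trans hm
  induction k with
  | zero => simp
  | succ k ih =>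
    have hlt : y / alphaF f ^ (k + 1) ∈ Ioo 0 (firstNode f) := by
      refine ⟨div_pos hy.1 (by positivity), ?_⟩
      rw [div_lt_iff₀ (by positivity), mul_comm]
      refine hy.2.trans_le (mul_le_mul_of_nonneg_right ?_ (hf.1.isNode_firstNode hfn).1.1.le)
      exact le_self_pow₀ hm.le k.succ_ne_zero
    rw [← phi_map_of_fstar_eq_one (hf.fstar_eq_one hfn hlt),
      hf.1.eq_alphaF_mul hfn (Ioo_subset_Icc_self hlt), ← ih]
    congr 1
    rw [pow_succ']
    field_simp

theorem MemF.psiA_eq_psi_fract {f : ℝ → ℝ} (hf : MemF f) (hfn : HasNode f) {c s : ℝ}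
    (hc : c ∈ Ioo 0 (firstNode f)) (hs : s < 1) :
    psiA f c s = psi f (Int.fract (s + Real.logb (alphaF f) (c / firstNode f))) := by
  have hm := hf.one_lt_alphaF hfn
  have hm0 : 0 < alphaF f := zero_lt_one.trans hm
  have hx := (hf.1.isNode_firstNode hfn).1.1
  set u := s + Real.logb (alphaF f) (c / firstNode f) with hu
  have hu1 : u < 1 := by
    have := Real.logb_neg hm (div_pos hc.1 hx) ((div_lt_one hx).2 hc.2)
    linarith
  obtain ⟨k, hk⟩ : ∃ k : ℕ, ⌊u⌋ = -(k : ℤ) := by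
    have : ⌊u⌋ < 1 := Int.floor_lt.2 (by exact_mod_cast hu1)
    exact ⟨(-⌊u⌋).toNat, by omega⟩
  have hfr : u = Int.fract u - k := by
    rw [Int.fract, hk]; push_cast; ring
  have hpow : alphaF f ^ s * c = alphaF f ^ Int.fract u * firstNode f / alphaF f ^ k := by
    have h1 : alphaF f ^ u = alphaF f ^ s * (c / firstNode f) := by
      rw [hu, Real.rpow_add hm0, Real.rpow_logb hm0 hm.ne' (div_pos hc.1 hx)]
    have h2 : alphaF f ^ u = alphaF f ^ Int.fract u / alphaF f ^ k := by
      rw [← Real.rpow_natCast, ← Real.rpow_sub hm0, ← hfr]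
    rw [mul_div_right_comm, ← h2, h1]
    field_simp
  rw [psi, psiA, psiA, hpow, hf.phi_div_alphaF_pow hfn]
  refine ⟨by positivity, mul_lt_mul_of_pos_right ?_ hx⟩
  simpa using Real.rpow_lt_rpow_of_exponent_lt hm (Int.fract_lt_one u)

theorem MemF.invFun_iterate_firstNode {f : ℝ → ℝ} (hf : MemF f) (hfn : HasNode f) (n : ℕ) :
    (invFun f)^[n] (firstNode f) = firstNode f / alphaF f ^ n := by
  have hm := hf.one_lt_alphaF hfn
  have hm0 : 0 < alphaF f := zero_lt_one.trans hm
  have hx := (hf.1.isNode_firstNode hfn).1.1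
  induction n with
  | zero => simp
  | succ n ih =>
    have hmem : firstNode f / alphaF f ^ (n + 1) ∈ Icc 0 (firstNode f) :=
      ⟨by positivity, div_le_self hx.le (one_le_pow₀ hm.le)⟩
    have hmap : f (firstNode f / alphaF f ^ (n + 1)) = firstNode f / alphaF f ^ n := by
      rw [hf.1.eq_alphaF_mul hfn hmem, pow_succ']
      field_simp
    rw [iterate_succ_apply', ih, ← hmap, leftInverse_invFun hf.1.injective]

/-- **Lemma 1, second part.** For `f ∈ 𝓕` with a node, `n ≥ 1`, `b = f⁻ⁿ(x_f)` and
`a ∈ (b, f b)`: with `m = α_f` and `t = log_m (a/b)` one has `ψ_f^a(s) = ψ_f(s + t mod 1)`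
for all `s ∈ 𝕊`; in particular every `ψ_f^a`, `a ∈ (0, x_f)`, agrees with `ψ_f` up to a
translation of the circle. -/
theorem psiA_eq_psi_translate (f : ℝ → ℝ) (hf : MemF f) (hfn : HasNode f)
    (n : ℕ) (hn : 0 < n) (b a : ℝ) (hb : b = (Function.invFun f)^[n] (firstNode f))
    (ha : a ∈ Set.Ioo b (f b)) :
    (∀ s ∈ Set.Ico (0 : ℝ) 1,
        psiA f a s = psi f (Int.fract (s + Real.logb (alphaF f) (a / b)))) ∧
    (∀ c ∈ Set.Ioo (0 : ℝ) (firstNode f),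
        ∃ t : ℝ, ∀ s ∈ Set.Ico (0 : ℝ) 1, psiA f c s = psi f (Int.fract (s + t))) := by
  have hm := hf.one_lt_alphaF hfn
  have hm0 : 0 < alphaF f := zero_lt_one.trans hm
  have hx := (hf.1.isNode_firstNode hfn).1.1
  refine ⟨fun s hs => ?_, fun c hc => ⟨_, fun s hs => hf.psiA_eq_psi_fract hfn hc hs.2⟩⟩
  rw [hf.invFun_iterate_firstNode hfn] at hb
  have hb0 : 0 < b := by rw [hb]; positivity
  have hbx : alphaF f * b ≤ firstNode f := by
    rw [hb, mul_div_assoc', div_le_iff₀ (by positivity), mul_comm]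
    exact mul_le_mul_of_nonneg_left (le_self_pow₀ hm.le hn.ne') hx.le
  have hfb : f b = alphaF f * b :=
    hf.1.eq_alphaF_mul hfn ⟨hb0.le, (le_mul_of_one_le_left hb0.le hm.le).trans hbx⟩
  have ha0 : 0 < a := hb0.trans ha.1
  have hlog : Real.logb (alphaF f) (a / b) =
      Real.logb (alphaF f) (a / firstNode f) + n := by
    have hab : a / b = a / firstNode f * alphaF f ^ n := by rw [hb]; field_simp
    rw [hab, Real.logb_mul (div_pos ha0 hx).ne' (by positivity), Real.logb_pow,
      Real.logb_self_eq_one hm, mul_one]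
  rw [hlog, ← add_assoc, Int.fract_add_natCast]
  exact hf.psiA_eq_psi_fract hfn ⟨ha0, (ha.2.trans_eq hfb).trans_le hbx⟩ hs.2
end

section
/- If f and g are members of 𝓕, each with at least one node, and f and g are conjugate in PLF⁺([0,1]), then β_f = β_g; that is, there exists p ∈ ℝ such that ψ_f(s) = ψ_g(s + p mod 1) for all s ∈ 𝕊. -/
open Set Function

namespace IsPLF

variable {f g h : ℝ → ℝ}

theorem map_mem_Icc (hf : IsPLF f) {x : ℝ} (hx : x ∈ Icc (0 : ℝ) 1) : f x ∈ Icc (0 : ℝ) 1 := by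
  have h0 := hf.strictMonoOn.monotoneOn (left_mem_Icc.2 zero_le_one) hx hx.1
  have h1 := hf.strictMonoOn.monotoneOn hx (right_mem_Icc.2 zero_le_one) hx.2
  rw [hf.map_zero] at h0
  rw [hf.map_one] at h1
  exact ⟨h0, h1⟩

theorem map_mem_Ioo (hf : IsPLF f) {x : ℝ} (hx : x ∈ Ioo (0 : ℝ) 1) : f x ∈ Ioo (0 : ℝ) 1 := by
  have h0 := hf.strictMonoOn (left_mem_Icc.2 zero_le_one) (Ioo_subset_Icc_self hx) hx.1
  have h1 := hf.strictMonoOn (Ioo_subset_Icc_self hx) (right_mem_Icc.2 zero_le_one) hx.2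
  rw [hf.map_zero] at h0
  rw [hf.map_one] at h1
  exact ⟨h0, h1⟩

theorem iterate_mem_Ioo (hf : IsPLF f) {x : ℝ} (hx : x ∈ Ioo (0 : ℝ) 1) (n : ℕ) :
    f^[n] x ∈ Ioo (0 : ℝ) 1 := by
  induction n with
  | zero => exact hx
  | succ n ih => rw [iterate_succ_apply']; exact hf.map_mem_Ioo ih

theorem strictMono (hf : IsPLF f) : StrictMono f := by
  intro x y hxy
  by_cases hx : x ∈ Icc (0 : ℝ) 1 <;> by_cases hy : y ∈ Icc (0 : ℝ) 1
  · exact hf.strictMonoOn hx hy hxy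
  · have := hf.map_mem_Icc hx
    rw [hf.eq_id y hy]
    rw [mem_Icc, not_and, not_le] at hy
    linarith [this.2, hy (hx.1.trans hxy.le)]
  · have := hf.map_mem_Icc hy
    rw [hf.eq_id x hx]
    rw [mem_Icc, not_and', not_le] at hx
    linarith [this.1, hx (hxy.le.trans hy.2)]
  · rwa [hf.eq_id x hx, hf.eq_id y hy]

theorem exists_forall_not_isNode (hf : IsPLF f) (x : ℝ) :
    ∃ ε > 0, ∀ y, y ≠ x → |y - x| < ε → ¬ IsNode f y := by
  have hcl : IsClosed ({y | IsNode f y} \ {x}) := (hf.finite_nodes.subset sdiff_subset).isClosed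
  obtain ⟨ε, hε, hball⟩ := Metric.mem_nhds_iff.1 (hcl.isOpen_compl.mem_nhds (x := x) (by simp))
  refine ⟨ε, hε, fun y hy hlt hn => hball (a := y) ?_ ⟨hn, hy⟩⟩
  rwa [Metric.mem_ball, Real.dist_eq]

end IsPLF

theorem exists_affine_of_forall_locallyAffineAt {f : ℝ → ℝ} {a b : ℝ} (hab : a < b)
    (hc : ContinuousOn f (Icc a b)) (hf : ∀ x ∈ Ioo a b, LocallyAffineAt f x) :
    ∃ m : ℝ, ∀ y ∈ Icc a b, f y = f a + m * (y - a) := by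
  have key : ∀ x ∈ Ioo a b, ∃ m : ℝ, HasDerivAt f m x ∧ deriv f =ᶠ[nhds x] fun _ => m := by
    intro x hx
    obtain ⟨m, c, hmc⟩ := hf x hx
    have haff : ∀ z : ℝ, HasDerivAt (fun y => m * y + c) m z := fun z => by
      simpa using ((hasDerivAt_id z).const_mul m).add_const c
    refine ⟨m, (haff x).congr_of_eventuallyEq hmc, ?_⟩
    filter_upwards [hmc.eventually_nhds] with z hz
    exact ((haff z).congr_of_eventuallyEq hz).deriv
  have hpre : IsPreconnected (Ioo a b) := isPreconnected_Ioo
  have hdf : DifferentiableOn ℝ f (Ioo a b) := fun x hx => by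
    obtain ⟨m, hm, -⟩ := key x hx
    exact hm.differentiableAt.differentiableWithinAt
  have hd2 : ∀ x ∈ Ioo a b, HasDerivAt (deriv f) 0 x := fun x hx => by
    obtain ⟨m, -, hm⟩ := key x hx
    exact (hasDerivAt_const x m).congr_of_eventuallyEq hm
  obtain ⟨m, hm⟩ := isOpen_Ioo.exists_is_const_of_deriv_eq_zero hpre
    (fun x hx => (hd2 x hx).differentiableAt.differentiableWithinAt)
    (fun x hx => (hd2 x hx).deriv)
  have hd3 : ∀ x ∈ Ioo a b, HasDerivAt (fun y => f y - m * y) 0 x := fun x hx => by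
    have h1 := (hdf.differentiableAt (isOpen_Ioo.mem_nhds hx)).hasDerivAt
    rw [hm x hx] at h1
    exact (h1.sub ((hasDerivAt_id x).const_mul m)).congr_deriv (by ring)
  obtain ⟨c, hcst⟩ := isOpen_Ioo.exists_is_const_of_deriv_eq_zero hpre
    (fun x hx => (hd3 x hx).differentiableAt.differentiableWithinAt)
    (fun x hx => (hd3 x hx).deriv)
  have hext : EqOn (fun y => f y - m * y) (fun _ => c) (Icc a b) := by
    refine EqOn.of_subset_closure (s := Ioo a b) hcst ?_ continuousOn_const Ioo_subset_Icc_self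
      (closure_Ioo hab.ne).ge
    fun_prop
  refine ⟨m, fun y hy => ?_⟩
  have h1 := hext hy
  have h2 := hext (left_mem_Icc.2 hab.le)
  simp only at h1 h2
  linarith

namespace IsPLF

variable {f g h : ℝ → ℝ}

theorem exists_affine (hf : IsPLF f) {a b : ℝ} (ha : 0 ≤ a) (hab : a < b) (hb : b ≤ 1)
    (hn : ∀ x ∈ Ioo a b, ¬ IsNode f x) :
    ∃ m > 0, ∀ y ∈ Icc a b, f y = f a + m * (y - a) := by
  obtain ⟨m, hm⟩ := exists_affine_of_forall_locallyAffineAt hab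
    (hf.continuousOn.mono (Icc_subset_Icc ha hb)) fun x hx => by
      by_contra hc
      exact hn x hx ⟨⟨ha.trans_lt hx.1, hx.2.trans_le hb⟩, hc⟩
  refine ⟨m, ?_, hm⟩
  have h1 := hf.strictMono hab
  rw [hm b (right_mem_Icc.2 hab.le)] at h1
  exact pos_of_mul_pos_left (by linarith) (sub_pos.2 hab).le

theorem hasDerivWithinAt_Ici (hf : IsPLF f) {x : ℝ} (hx : x ∈ Ioo (0 : ℝ) 1) :
    0 < rightDeriv f x ∧ HasDerivWithinAt f (rightDeriv f x) (Ici x) x := by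
  obtain ⟨ε, hε, hn⟩ := hf.exists_forall_not_isNode x
  obtain ⟨b, hxb, hb⟩ := exists_between (lt_min (lt_add_of_pos_right x hε) hx.2)
  obtain ⟨hb1, hb2⟩ := lt_min_iff.1 hb
  obtain ⟨m, hm, haff⟩ := hf.exists_affine hx.1.le hxb hb2.le fun y hy =>
    hn y hy.1.ne' (by rw [abs_lt]; constructor <;> linarith [hy.1, hy.2])
  have hd : HasDerivWithinAt f m (Ici x) x := by
    have h1 : HasDerivAt (fun y => f x + m * (y - x)) m x := by
      simpa using (((hasDerivAt_id x).sub_const x).const_mul m).const_add (f x)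
    refine h1.hasDerivWithinAt.congr_of_eventuallyEq ?_ (by simp)
    filter_upwards [Icc_mem_nhdsGE hxb] with y hy using haff y hy
  have : rightDeriv f x = m := hd.derivWithin (uniqueDiffWithinAt_Ici x)
  rw [this]
  exact ⟨hm, hd⟩

theorem hasDerivWithinAt_Iic_of_affine {a x m : ℝ} (hax : a < x)
    (haff : ∀ y ∈ Icc a x, f y = f a + m * (y - a)) : HasDerivWithinAt f m (Iic x) x := by
  have h1 : HasDerivAt (fun y => f a + m * (y - a)) m x := by
    simpa using (((hasDerivAt_id x).sub_const a).const_mul m).const_add (f a)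
  refine h1.hasDerivWithinAt.congr_of_eventuallyEq ?_ (haff x (right_mem_Icc.2 hax.le))
  filter_upwards [Icc_mem_nhdsLE hax] with y hy using haff y hy

theorem hasDerivWithinAt_Iic (hf : IsPLF f) {x : ℝ} (hx : x ∈ Ioo (0 : ℝ) 1) :
    0 < leftDeriv f x ∧ HasDerivWithinAt f (leftDeriv f x) (Iic x) x := by
  obtain ⟨ε, hε, hn⟩ := hf.exists_forall_not_isNode x
  obtain ⟨a, ha, hax⟩ := exists_between (max_lt (sub_lt_self x hε) hx.1)
  obtain ⟨ha1, ha2⟩ := max_lt_iff.1 ha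
  obtain ⟨m, hm, haff⟩ := hf.exists_affine ha2.le hax hx.2.le fun y hy =>
    hn y hy.2.ne (by rw [abs_lt]; constructor <;> linarith [hy.1, hy.2])
  have hd := hasDerivWithinAt_Iic_of_affine hax haff
  have : leftDeriv f x = m := hd.derivWithin (uniqueDiffWithinAt_Iic x)
  rw [this]
  exact ⟨hm, hd⟩

theorem fstar_eq_one (hf : IsPLF f) {x : ℝ} (hx : x ∈ Ioo (0 : ℝ) 1) (hn : ¬ IsNode f x) :
    fstar f x = 1 := by
  have hla : LocallyAffineAt f x := by
    by_contra hc
    exact hn ⟨hx, hc⟩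
  obtain ⟨m, c, hmc⟩ := hla
  have h1 : HasDerivAt f m x := HasDerivAt.congr_of_eventuallyEq
    (by simpa using ((hasDerivAt_id x).const_mul m).add_const c) hmc
  have hr : rightDeriv f x = m := h1.hasDerivWithinAt.derivWithin (uniqueDiffWithinAt_Ici x)
  have hl : leftDeriv f x = m := h1.hasDerivWithinAt.derivWithin (uniqueDiffWithinAt_Iic x)
  have hpos := (hf.hasDerivWithinAt_Ici hx).1
  rw [fstar, hr, hl, div_self]
  rw [hr] at hpos
  exact hpos.ne'

theorem rightDeriv_comp (hf : IsPLF f) (hg : IsPLF g) {x : ℝ} (hx : x ∈ Ioo (0 : ℝ) 1) :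
    rightDeriv (g ∘ f) x = rightDeriv g (f x) * rightDeriv f x :=
  ((hg.hasDerivWithinAt_Ici (hf.map_mem_Ioo hx)).2.comp x (hf.hasDerivWithinAt_Ici hx).2
    fun _ hy => hf.strictMono.monotone hy).derivWithin (uniqueDiffWithinAt_Ici x)

theorem leftDeriv_comp (hf : IsPLF f) (hg : IsPLF g) {x : ℝ} (hx : x ∈ Ioo (0 : ℝ) 1) :
    leftDeriv (g ∘ f) x = leftDeriv g (f x) * leftDeriv f x :=
  ((hg.hasDerivWithinAt_Iic (hf.map_mem_Ioo hx)).2.comp x (hf.hasDerivWithinAt_Iic hx).2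
    fun _ hy => hf.strictMono.monotone hy).derivWithin (uniqueDiffWithinAt_Iic x)

theorem fstar_comp (hf : IsPLF f) (hg : IsPLF g) {x : ℝ} (hx : x ∈ Ioo (0 : ℝ) 1) :
    fstar (g ∘ f) x = fstar g (f x) * fstar f x := by
  rw [fstar, rightDeriv_comp hf hg hx, leftDeriv_comp hf hg hx, fstar, fstar, div_mul_div_comm]

theorem prod_fstar_semiconj (hf : IsPLF f) (hg : IsPLF g) (hh : IsPLF h)
    (hsc : Semiconj h f g) {x : ℝ} (hx : x ∈ Ioo (0 : ℝ) 1) (N : ℕ) :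
    (∏ n ∈ Finset.range N, fstar g (g^[n] (h x))) * fstar h x =
      fstar h (f^[N] x) * ∏ n ∈ Finset.range N, fstar f (f^[n] x) := by
  induction N with
  | zero => simp
  | succ N ih =>
    have hxN := hf.iterate_mem_Ioo hx N
    have hchain : fstar g (h (f^[N] x)) * fstar h (f^[N] x) =
        fstar h (f (f^[N] x)) * fstar f (f^[N] x) := by
      rw [← fstar_comp hh hg hxN, ← fstar_comp hf hh hxN, hsc.comp_eq]
    rw [Finset.prod_range_succ, Finset.prod_range_succ, iterate_succ_apply',
      ← (hsc.iterate_right N).eq x]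
    linear_combination fstar g (h (f^[N] x)) * ih +
      (∏ n ∈ Finset.range N, fstar f (f^[n] x)) * hchain

end IsPLF

namespace MemF

variable {f g h : ℝ → ℝ}

theorem tendsto_iterate (hf : MemF f) {x : ℝ} (hx : x ∈ Ioo (0 : ℝ) 1) :
    Filter.Tendsto (fun n => f^[n] x) Filter.atTop (nhds 1) := by
  have hmem := hf.1.iterate_mem_Ioo hx
  have hmono : Monotone fun n => f^[n] x := monotone_nat_of_le_succ fun n => by
    simp only [iterate_succ_apply']
    exact (hf.2 _ (hmem n)).le
  have hbdd : BddAbove (range fun n => f^[n] x) :=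
    ⟨1, by rintro _ ⟨n, rfl⟩; exact (hmem n).2.le⟩
  have hlim := tendsto_atTop_ciSup hmono hbdd
  set l := ⨆ n, f^[n] x
  have hl0 : 0 < l := hx.1.trans_le (le_ciSup hbdd 0)
  have hl1 : l ≤ 1 := ciSup_le fun n => (hmem n).2.le
  have hlim' : Filter.Tendsto (fun n => f^[n] x) Filter.atTop (nhdsWithin l (Icc 0 1)) :=
    tendsto_nhdsWithin_iff.2 ⟨hlim, Filter.Eventually.of_forall fun n =>
      Ioo_subset_Icc_self (hmem n)⟩
  have hcont := (hf.1.continuousOn l ⟨hl0.le, hl1⟩).tendsto.comp hlim'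
  have hsucc := hlim.comp (Filter.tendsto_add_atTop_nat 1)
  have hfix : f l = l := by
    refine tendsto_nhds_unique hcont (hsucc.congr fun n => ?_)
    simp only [comp_apply, iterate_succ_apply']
  rcases hl1.eq_or_lt with h1 | h1
  · rwa [h1] at hlim
  · exact absurd hfix (hf.2 l ⟨hl0, h1⟩).ne'

theorem eventually_fstar_iterate_eq_one (hf : MemF f) (hh : IsPLF h) {x : ℝ}
    (hx : x ∈ Ioo (0 : ℝ) 1) : ∀ᶠ n in Filter.atTop, fstar h (f^[n] x) = 1 := by
  obtain ⟨ε, hε, hn⟩ := hh.exists_forall_not_isNode 1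
  filter_upwards [(hf.tendsto_iterate hx).eventually (Metric.ball_mem_nhds 1 hε)] with n hball
  have hmem := hf.1.iterate_mem_Ioo hx n
  exact hh.fstar_eq_one hmem (hn _ hmem.2.ne hball)

theorem eventually_phi_eq_prod (hf : MemF f) {x : ℝ} (hx : x ∈ Ioo (0 : ℝ) 1) :
    ∀ᶠ N in Filter.atTop, phi f x = ∏ n ∈ Finset.range N, fstar f (f^[n] x) := by
  obtain ⟨N₀, hN₀⟩ := Filter.eventually_atTop.1 (hf.eventually_fstar_iterate_eq_one hf.1 hx)
  filter_upwards [Filter.eventually_ge_atTop N₀] with N hN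
  refine tprod_eq_prod fun n hn => hN₀ n ?_
  rw [Finset.mem_range, not_lt] at hn
  exact hN.trans hn

theorem phi_semiconj (hf : MemF f) (hg : MemF g) (hh : IsPLF h) (hsc : Semiconj h f g) {x : ℝ}
    (hx : x ∈ Ioo (0 : ℝ) 1) : phi g (h x) * fstar h x = phi f x := by
  obtain ⟨N, h1, h2, h3⟩ := ((hf.eventually_phi_eq_prod hx).and
    ((hg.eventually_phi_eq_prod (hh.map_mem_Ioo hx)).and
      (hf.eventually_fstar_iterate_eq_one hh hx))).exists
  rw [h1, h2, hf.1.prod_fstar_semiconj hg.1 hh hsc hx, h3, one_mul]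

theorem phi_map_of_not_isNode (hf : MemF f) {x : ℝ} (hx : x ∈ Ioo (0 : ℝ) 1)
    (hn : ¬ IsNode f x) : phi f (f x) = phi f x := by
  rw [← hf.phi_semiconj hf hf.1 (fun _ => rfl) hx, hf.1.fstar_eq_one hx hn, mul_one]

theorem isNode_firstNode (hf : MemF f) (hfn : HasNode f) : IsNode f (firstNode f) :=
  Set.Nonempty.csInf_mem hfn hf.1.finite_nodes

theorem not_isNode_of_lt_firstNode (hf : MemF f) {x : ℝ} (hx : x < firstNode f) :
    ¬ IsNode f x := fun hn =>
  hx.not_ge (csInf_le hf.1.finite_nodes.bddBelow hn)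

theorem eq_alphaF_mul (hf : MemF f) (hfn : HasNode f) {x : ℝ} (hx : x ∈ Icc 0 (firstNode f)) :
    f x = alphaF f * x := by
  have hmem := (hf.isNode_firstNode hfn).1
  obtain ⟨m, -, haff⟩ := hf.1.exists_affine le_rfl hmem.1 hmem.2.le
    fun y hy => hf.not_isNode_of_lt_firstNode hy.2
  have : alphaF f = m := (IsPLF.hasDerivWithinAt_Iic_of_affine hmem.1 haff).derivWithin
    (uniqueDiffWithinAt_Iic _)
  rw [this, haff x hx, hf.1.map_zero]
  ring

theorem one_lt_alphaF_s3 (hf : MemF f) (hfn : HasNode f) : 1 < alphaF f := by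
  have hmem := (hf.isNode_firstNode hfn).1
  have h1 := hf.2 _ hmem
  rw [hf.eq_alphaF_mul hfn (right_mem_Icc.2 hmem.1.le)] at h1
  exact (lt_mul_iff_one_lt_left hmem.1).1 h1

theorem psi_sub_natCast (hf : MemF f) (hfn : HasNode f) {s : ℝ} (hs : s < 1) (n : ℕ) :
    psi f (s - n) = psi f s := by
  induction n with
  | zero => simp
  | succ n ih =>
    have hmem := (hf.isNode_firstNode hfn).1
    have hα := hf.one_lt_alphaF_s3 hfn
    have hα0 : 0 < alphaF f := one_pos.trans hα
    have hneg : s - ((n + 1 : ℕ) : ℝ) < 0 := by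
      push_cast
      linarith [n.cast_nonneg (α := ℝ)]
    have hlt : alphaF f ^ (s - ((n + 1 : ℕ) : ℝ)) * firstNode f < firstNode f :=
      mul_lt_of_lt_one_left hmem.1 (Real.rpow_lt_one_of_one_lt_of_neg hα hneg)
    have hpos : 0 < alphaF f ^ (s - ((n + 1 : ℕ) : ℝ)) * firstNode f :=
      mul_pos (Real.rpow_pos_of_pos hα0 _) hmem.1
    have hexp : alphaF f ^ (s - n) = alphaF f * alphaF f ^ (s - ((n + 1 : ℕ) : ℝ)) := by
      rw [show s - n = 1 + (s - ((n + 1 : ℕ) : ℝ)) by push_cast; ring, Real.rpow_add hα0,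
        Real.rpow_one]
    rw [← ih, psi, psi, psiA, psiA, ← hf.phi_map_of_not_isNode ⟨hpos, hlt.trans hmem.2⟩
      (hf.not_isNode_of_lt_firstNode hlt), hf.eq_alphaF_mul hfn ⟨hpos.le, hlt.le⟩, ← mul_assoc,
      hexp]

end MemF

theorem IsPLF.exists_linear_near_zero {h : ℝ → ℝ} (hh : IsPLF h) :
    ∃ ε > 0, ε ≤ 1 ∧ ∃ m > 0, ∀ x ∈ Ioo 0 ε, h x = m * x ∧ fstar h x = 1 := by
  obtain ⟨ε, hε, hn⟩ := hh.exists_forall_not_isNode 0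
  have hn' : ∀ x ∈ Ioo 0 (min ε 1), ¬ IsNode h x := fun x hx =>
    hn x hx.1.ne' (by
      rw [sub_zero, abs_of_pos hx.1]
      exact hx.2.trans_le (min_le_left _ _))
  obtain ⟨m, hm, haff⟩ := hh.exists_affine le_rfl (lt_min hε one_pos) (min_le_right _ _) hn'
  refine ⟨min ε 1, lt_min hε one_pos, min_le_right _ _, m, hm, fun x hx => ⟨?_, ?_⟩⟩
  · rw [haff x (Ioo_subset_Icc_self hx), hh.map_zero]
    ring
  · exact hh.fstar_eq_one ⟨hx.1, hx.2.trans_le (min_le_right _ _)⟩ (hn' x hx)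

theorem IsConjPLF.exists_semiconj {f g : ℝ → ℝ} (hconj : IsConjPLF f g) :
    ∃ h, IsPLF h ∧ Semiconj h f g := by
  obtain ⟨h, hh, rfl⟩ := hconj
  refine ⟨h, hh, fun x => ?_⟩
  simp only [comp_apply, leftInverse_invFun hh.strictMono.injective x]

theorem alphaF_eq_of_semiconj {f g h : ℝ → ℝ} (hf : MemF f) (hg : MemF g) (hfn : HasNode f)
    (hgn : HasNode g) (hh : IsPLF h) (hsc : Semiconj h f g) : alphaF f = alphaF g := by
  obtain ⟨ε, hε, -, m, hm, hlin⟩ := hh.exists_linear_near_zero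
  have hxf := (hf.isNode_firstNode hfn).1.1
  have hxg := (hg.isNode_firstNode hgn).1.1
  have hα0 : 0 < alphaF f := one_pos.trans (hf.one_lt_alphaF_s3 hfn)
  obtain ⟨x, hx0, hx⟩ := exists_between (lt_min (lt_min hε (div_pos hε hα0))
    (lt_min hxf (div_pos hxg hm)))
  simp only [lt_min_iff, lt_div_iff₀ hα0, lt_div_iff₀ hm] at hx
  obtain ⟨⟨h1, h2⟩, h3, h4⟩ := hx
  have heq := hsc.eq x
  rw [hf.eq_alphaF_mul hfn ⟨hx0.le, h3.le⟩,
    (hlin _ ⟨mul_pos hα0 hx0, by linarith⟩).1, (hlin x ⟨hx0, h1⟩).1,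
    hg.eq_alphaF_mul hgn ⟨(mul_pos hm hx0).le, by linarith⟩] at heq
  exact mul_right_cancel₀ (mul_pos hm hx0).ne' (by linear_combination heq)

/-- **Lemma 2.** If `f, g ∈ 𝓕`, each with at least one node, are conjugate in
`PLF⁺([0,1])`, then `β_f = β_g`: there is `p ∈ ℝ` with `ψ_f(s) = ψ_g(s + p mod 1)`
for all `s ∈ 𝕊`. -/
theorem beta_conj_invariant (f g : ℝ → ℝ)
    (hf : MemF f) (hg : MemF g) (hfn : HasNode f) (hgn : HasNode g)
    (hconj : IsConjPLF f g) :
    ∃ p : ℝ, ∀ s ∈ Set.Ico (0 : ℝ) 1, psi f s = psi g (Int.fract (s + p)) := by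
  obtain ⟨h, hh, hsc⟩ := hconj.exists_semiconj
  have hα := alphaF_eq_of_semiconj hf hg hfn hgn hh hsc
  obtain ⟨ε, hε, hε1, m, hm, hlin⟩ := hh.exists_linear_near_zero
  have hxf := (hf.isNode_firstNode hfn).1.1
  have hxg := (hg.isNode_firstNode hgn).1.1
  have hα1 := hg.one_lt_alphaF_s3 hgn
  have hα0 : 0 < alphaF g := one_pos.trans hα1
  set p := Real.logb (alphaF g) (m * firstNode f / firstNode g) with hp
  have hαp : alphaF g ^ p = m * firstNode f / firstNode g :=
    Real.rpow_logb hα0 hα1.ne' (by positivity)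
  refine ⟨p, fun s hs => ?_⟩
  obtain ⟨N, hN⟩ := exists_nat_gt
    (max (s - Real.logb (alphaF g) (ε / firstNode f)) (⌊s + p⌋ : ℝ))
  obtain ⟨hN1, hN2⟩ := max_lt_iff.1 hN
  obtain ⟨M, hM⟩ := Int.eq_ofNat_of_zero_le (a := N - ⌊s + p⌋)
    (sub_nonneg.2 (by exact_mod_cast hN2.le))
  have hM' : (N : ℝ) - ⌊s + p⌋ = M := by exact_mod_cast hM
  have hpos : 0 < alphaF g ^ (s - N) * firstNode f := mul_pos (Real.rpow_pos_of_pos hα0 _) hxf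
  have hlt : alphaF g ^ (s - N) * firstNode f < ε := by
    rw [← lt_div_iff₀ hxf, ← Real.lt_logb_iff_rpow_lt hα1 (div_pos hε hxf)]
    linarith
  obtain ⟨hlin1, hlin2⟩ := hlin _ ⟨hpos, hlt⟩
  have hphi := hf.phi_semiconj hg hh hsc ⟨hpos, hlt.trans_le hε1⟩
  rw [hlin1, hlin2, mul_one] at hphi
  rw [← hf.psi_sub_natCast hfn hs.2 N, ← hg.psi_sub_natCast hgn (Int.fract_lt_one (s + p)) M,
    psi, psi, psiA, psiA, hα, ← hphi]
  congr 1
  have hexp : Int.fract (s + p) - M = s - N + p := by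
    rw [← hM', Int.fract]
    ring
  rw [hexp, Real.rpow_add hα0, hαp]
  field_simp
end
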